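/- Let a, b, c ∈ ℝ with a ≤ 0 and c > b > 0, and let z ∈ [0,1]. Then 0 < Γ(c)·Γ(c−b−a)/(Γ(c−b)·Γ(c−a)) ≤ F(a,b;c;z) ≤ 1, where Γ is the real Gamma function. -/

import Mathlib

/-- The rising factorial (Pochhammer symbol) `(x)_j = x(x+1)⋯(x+j-1)`. -/
noncomputable def risingFactorial (j : ℕ) (x : ℝ) : ℝ := (ascPochhammer ℝ j).eval x

/-- The Gauss hypergeometric function `F(a,b;c;z) = ∑_{j=0}^∞ ((a)_j (b)_j/((c)_j j!)) z^j`. -/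
noncomputable def hypF (a b c z : ℝ) : ℝ :=
  ∑' j : ℕ, risingFactorial j a * risingFactorial j b
    / (risingFactorial j c * (Nat.factorial j : ℝ)) * z ^ j

open MeasureTheory ProbabilityTheory Set

theorem risingFactorial_zero (x : ℝ) : risingFactorial 0 x = 1 := by
  simp [risingFactorial]

theorem risingFactorial_succ (n : ℕ) (x : ℝ) :
    risingFactorial (n + 1) x = risingFactorial n x * (x + n) :=
  ascPochhammer_succ_eval n x

theorem risingFactorial_pos (n : ℕ) {x : ℝ} (hx : 0 < x) : 0 < risingFactorial n x :=
  ascPochhammer_pos n x hx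

theorem integrableOn_rpow_mul_one_sub_rpow {u v : ℝ} (hu : 0 < u) (hv : 0 < v) :
    IntegrableOn (fun t : ℝ ↦ t ^ (u - 1) * (1 - t) ^ (v - 1)) (Ioo 0 1) ∧
      ∫ t in Ioo (0 : ℝ) 1, t ^ (u - 1) * (1 - t) ^ (v - 1) = beta u v := by
  have hc := Complex.betaIntegral_convergent (u := u) (v := v) (by simpa) (by simpa)
  rw [intervalIntegrable_iff_integrableOn_Ioo_of_le zero_le_one] at hc
  have key : EqOn
      (fun t : ℝ ↦ (t : ℂ) ^ ((u : ℂ) - 1) * (1 - (t : ℂ)) ^ ((v : ℂ) - 1))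
      (fun t : ℝ ↦ ((t ^ (u - 1) * (1 - t) ^ (v - 1) : ℝ) : ℂ)) (Ioo 0 1) := by
    intro t ht
    have h0 : 0 ≤ t := ht.1.le
    have h1 : 0 ≤ 1 - t := by linarith [ht.2]
    simp only []
    push_cast [Complex.ofReal_cpow h0, Complex.ofReal_cpow h1]
    rfl
  have hint : IntegrableOn (fun t : ℝ ↦ t ^ (u - 1) * (1 - t) ^ (v - 1)) (Ioo 0 1) := by
    have := (hc.congr_fun key measurableSet_Ioo).re
    simpa only [RCLike.re_to_complex, Complex.ofReal_re] using! this
  refine ⟨hint, ?_⟩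
  rw [beta_eq_betaIntegralReal u v hu hv, Complex.betaIntegral,
    intervalIntegral.integral_of_le zero_le_one, integral_Ioc_eq_integral_Ioo,
    setIntegral_congr_fun measurableSet_Ioo key, integral_complex_ofReal, Complex.ofReal_re]

theorem beta_add_one_left {u v : ℝ} (hu : 0 < u) (hv : 0 < v) :
    beta (u + 1) v = u / (u + v) * beta u v := by
  have huv : u + v ≠ 0 := (add_pos hu hv).ne'
  have := Real.Gamma_pos_of_pos (add_pos hu hv)
  rw [beta, beta, show u + 1 + v = u + v + 1 by ring, Real.Gamma_add_one hu.ne',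
    Real.Gamma_add_one huv]
  field_simp

theorem beta_add_nat_left {u v : ℝ} (hu : 0 < u) (hv : 0 < v) (n : ℕ) :
    beta (u + n) v = risingFactorial n u / risingFactorial n (u + v) * beta u v := by
  induction n with
  | zero => simp [risingFactorial_zero]
  | succ n ih =>
    have hn : 0 < u + n := by positivity
    have := risingFactorial_pos n (add_pos hu hv)
    have h2 : 0 < u + v + n := by positivity
    rw [Nat.cast_succ, ← add_assoc, beta_add_one_left hn hv, ih, risingFactorial_succ,
      risingFactorial_succ, show u + n + v = u + v + n by ring]
    field_simp

theorem hasSum_risingFactorial_div_factorial_mul_pow (a : ℝ) {x : ℝ} (hx : |x| < 1) :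
    HasSum (fun n : ℕ ↦ risingFactorial n a / (n.factorial : ℝ) * x ^ n) ((1 - x) ^ (-a)) := by
  have h := (Real.one_div_one_sub_rpow_hasFPowerSeriesOnBall_zero a).hasSum
    (y := x) (by simpa [← ofReal_norm, Real.norm_eq_abs] using hx)
  have hx1 : 0 ≤ 1 - x := by linarith [(abs_lt.mp hx).2]
  rw [zero_add, one_div, ← Real.rpow_neg hx1] at h
  refine h.congr_fun ?_
  intro n
  have hc : Ring.choose (a + n - 1) n = risingFactorial n a / (n.factorial : ℝ) := by
    rw [← Ring.multichoose_eq, eq_div_iff (by positivity), mul_comm, ← nsmul_eq_mul,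
      Ring.factorial_nsmul_multichoose_eq_ascPochhammer, Polynomial.ascPochhammer_smeval_eq_eval,
      risingFactorial]
  simp [hc, mul_comm]

theorem summable_abs_risingFactorial_div_factorial {a : ℝ} (ha : a ≤ 0) :
    Summable fun n : ℕ ↦ |risingFactorial n a / (n.factorial : ℝ)| := by
  set f : ℕ → ℝ := fun n ↦ |risingFactorial n a / (n.factorial : ℝ)| with hf
  have hrec : ∀ n : ℕ, (n + 1) * f (n + 1) = |a + n| * f n := by
    intro n
    have hn : (0 : ℝ) < n + 1 := by positivity
    simp only [hf, risingFactorial_succ, Nat.factorial_succ, abs_div, abs_mul, Nat.cast_mul,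
      Nat.cast_succ, abs_of_pos hn]
    field_simp
  obtain ⟨N, hN⟩ := exists_nat_gt (-a)
  rw [← summable_nat_add_iff N]
  rcases ha.eq_or_lt with rfl | ha
  · have hz : ∀ n, f (n + 1) = 0 := by
      intro n
      have : risingFactorial (n + 1) 0 = 0 := by simp [risingFactorial]
      simp [hf, this]
    have : 0 < N := by simpa using hN
    refine summable_zero.congr fun n ↦ ?_
    rw [show n + N = n + N - 1 + 1 by omega, hz]
  have htel : ∀ M : ℕ, -a * ∑ n ∈ Finset.range M, f (n + N) = N * f N - (M + N) * f (M + N) := by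
    intro M
    induction M with
    | zero => simp
    | succ M ih =>
      have h := hrec (M + N)
      rw [abs_of_pos (by push_cast; linarith [M.cast_nonneg (α := ℝ)])] at h
      rw [Finset.sum_range_succ, mul_add, ih, show M + 1 + N = M + N + 1 by ring]
      push_cast at h ⊢
      linarith
  refine summable_of_sum_range_le (c := N * f N / -a) (fun n ↦ abs_nonneg _) fun M ↦ ?_
  rw [le_div_iff₀ (by linarith), mul_comm, htel]
  have : 0 ≤ (M + N) * f (M + N) := mul_nonneg (by positivity) (abs_nonneg _)
  linarith

/-- The Euler integral representation of the Gauss hypergeometric function. -/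
theorem beta_mul_hypF_eq_integral {a b c z : ℝ} (ha : a ≤ 0) (hb : 0 < b) (hcb : b < c)
    (hz : z ∈ Icc (0 : ℝ) 1) :
    beta b (c - b) * hypF a b c z =
      ∫ t in Ioo (0 : ℝ) 1, t ^ (b - 1) * (1 - t) ^ (c - b - 1) * (1 - z * t) ^ (-a) := by
  have hv : 0 < c - b := sub_pos.2 hcb
  set q : ℕ → ℝ := fun n ↦ risingFactorial n a / (n.factorial : ℝ) with hq
  set w : ℕ → ℝ → ℝ := fun n t ↦ t ^ (b + n - 1) * (1 - t) ^ (c - b - 1) with hw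
  have hwi : ∀ n, IntegrableOn (w n) (Ioo 0 1) := fun n ↦
    (integrableOn_rpow_mul_one_sub_rpow (by positivity) hv).1
  have hwv : ∀ n, ∫ t in Ioo (0 : ℝ) 1, w n t = beta (b + n) (c - b) := fun n ↦
    (integrableOn_rpow_mul_one_sub_rpow (by positivity) hv).2
  have hw0 : ∀ n, ∀ t ∈ Ioo (0 : ℝ) 1, 0 ≤ w n t := fun n t ht ↦
    mul_nonneg (Real.rpow_nonneg ht.1.le _) (Real.rpow_nonneg (by linarith [ht.2]) _)
  have hwn : ∀ n, ∀ t ∈ Ioo (0 : ℝ) 1, w n t = t ^ (b - 1) * (1 - t) ^ (c - b - 1) * t ^ n := by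
    intro n t ht
    simp only [hw]
    rw [show b + n - 1 = b - 1 + n by ring, Real.rpow_add_natCast ht.1.ne']
    ring
  have hwle : ∀ n, ∫ t in Ioo (0 : ℝ) 1, w n t ≤ ∫ t in Ioo (0 : ℝ) 1, w 0 t := by
    intro n
    refine setIntegral_mono_on (hwi n) (hwi 0) measurableSet_Ioo fun t ht ↦ ?_
    rw [hwn n t ht, hwn 0 t ht, pow_zero]
    have := hw0 0 t ht
    rw [hwn 0 t ht, pow_zero, mul_one] at this
    exact mul_le_mul_of_nonneg_left (pow_le_one₀ ht.1.le ht.2.le) this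
  have hsum := hasSum_integral_of_summable_integral_norm (μ := volume.restrict (Ioo (0 : ℝ) 1))
    (F := fun n t ↦ q n * z ^ n * w n t) (fun n ↦ (hwi n).const_mul _) <| by
      refine ((summable_abs_risingFactorial_div_factorial ha).mul_right
        (∫ t in Ioo (0 : ℝ) 1, w 0 t)).of_nonneg_of_le
        (fun n ↦ integral_nonneg fun t ↦ norm_nonneg _) fun n ↦ ?_
      have hnorm : ∫ t in Ioo (0 : ℝ) 1, ‖q n * z ^ n * w n t‖ =
          |q n| * z ^ n * ∫ t in Ioo (0 : ℝ) 1, w n t := by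
        rw [← integral_const_mul]
        refine setIntegral_congr_fun measurableSet_Ioo fun t ht ↦ ?_
        simp only [norm_mul, Real.norm_eq_abs, abs_of_nonneg (hw0 n t ht),
          abs_of_nonneg (pow_nonneg hz.1 n)]
      rw [hnorm]
      refine mul_le_mul ?_ (hwle n) (setIntegral_nonneg measurableSet_Ioo (hw0 n)) (abs_nonneg _)
      exact mul_le_of_le_one_right (abs_nonneg _) (pow_le_one₀ hz.1 hz.2)
  have hint : ∫ t in Ioo (0 : ℝ) 1, ∑' n, q n * z ^ n * w n t =
      ∫ t in Ioo (0 : ℝ) 1, t ^ (b - 1) * (1 - t) ^ (c - b - 1) * (1 - z * t) ^ (-a) := by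
    refine setIntegral_congr_fun measurableSet_Ioo fun t ht ↦ ?_
    have hzt : |z * t| < 1 := by
      rw [abs_of_nonneg (mul_nonneg hz.1 ht.1.le)]
      exact (mul_le_of_le_one_left ht.1.le hz.2).trans_lt ht.2
    refine (((hasSum_risingFactorial_div_factorial_mul_pow a hzt).mul_left
      (t ^ (b - 1) * (1 - t) ^ (c - b - 1))).congr_fun fun n ↦ ?_).tsum_eq
    rw [hwn n t ht, mul_pow]
    ring
  rw [← hint, ← hsum.tsum_eq, hypF, ← tsum_mul_left]
  refine tsum_congr fun n ↦ ?_
  rw [integral_const_mul, hwv, beta_add_nat_left hb hv, add_sub_cancel]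
  have := risingFactorial_pos n (hb.trans hcb)
  simp only [hq]
  field_simp

/-- For `a ≤ 0`, `c > b > 0`, and `z ∈ [0,1]`, the bounds
`0 < Γ(c)Γ(c-b-a)/(Γ(c-b)Γ(c-a)) ≤ F(a,b;c;z) ≤ 1` hold. -/
theorem hypergeometric_bounds
    (a b c : ℝ) (ha : a ≤ 0) (hb : 0 < b) (hcb : b < c)
    (z : ℝ) (hz : z ∈ Set.Icc (0:ℝ) 1) :
    0 < Real.Gamma c * Real.Gamma (c - b - a)
        / (Real.Gamma (c - b) * Real.Gamma (c - a)) ∧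
    Real.Gamma c * Real.Gamma (c - b - a) / (Real.Gamma (c - b) * Real.Gamma (c - a))
      ≤ hypF a b c z ∧
    hypF a b c z ≤ 1 := by
  have hv : 0 < c - b := sub_pos.2 hcb
  have hva : 0 < c - b - a := by linarith
  have gb := Real.Gamma_pos_of_pos hb
  have gc := Real.Gamma_pos_of_pos (hb.trans hcb)
  have gv := Real.Gamma_pos_of_pos hv
  have gva := Real.Gamma_pos_of_pos hva
  have gca := Real.Gamma_pos_of_pos (show 0 < c - a by linarith)
  have hB := beta_pos hb hv
  have hratio : beta b (c - b) * (Real.Gamma c * Real.Gamma (c - b - a)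
      / (Real.Gamma (c - b) * Real.Gamma (c - a))) = beta b (c - b - a) := by
    rw [beta, beta, add_sub_cancel, show b + (c - b - a) = c - a by ring]
    field_simp
  obtain ⟨hi, hI⟩ := integrableOn_rpow_mul_one_sub_rpow hb hv
  obtain ⟨hia, hIa⟩ := integrableOn_rpow_mul_one_sub_rpow hb hva
  have hw0 : ∀ t ∈ Ioo (0 : ℝ) 1, 0 ≤ t ^ (b - 1) * (1 - t) ^ (c - b - 1) := fun t ht ↦
    mul_nonneg (Real.rpow_nonneg ht.1.le _) (Real.rpow_nonneg (by linarith [ht.2]) _)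
  have hzt : ∀ t ∈ Ioo (0 : ℝ) 1, 1 - t ≤ 1 - z * t := fun t ht ↦ by
    linarith [mul_le_of_le_one_left ht.1.le hz.2]
  have hle : ∀ t ∈ Ioo (0 : ℝ) 1, t ^ (b - 1) * (1 - t) ^ (c - b - 1) * (1 - z * t) ^ (-a) ≤
      t ^ (b - 1) * (1 - t) ^ (c - b - 1) := fun t ht ↦
    mul_le_of_le_one_right (hw0 t ht) <| Real.rpow_le_one (by linarith [hzt t ht, ht.2])
      (by linarith [mul_nonneg hz.1 ht.1.le]) (by linarith)
  have hge : ∀ t ∈ Ioo (0 : ℝ) 1, t ^ (b - 1) * (1 - t) ^ (c - b - a - 1) ≤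
      t ^ (b - 1) * (1 - t) ^ (c - b - 1) * (1 - z * t) ^ (-a) := fun t ht ↦ by
    have h1 : 0 < 1 - t := by linarith [ht.2]
    rw [show c - b - a - 1 = c - b - 1 + -a by ring, Real.rpow_add h1, ← mul_assoc]
    exact mul_le_mul_of_nonneg_left (Real.rpow_le_rpow h1.le (hzt t ht) (by linarith)) (hw0 t ht)
  have him : IntegrableOn
      (fun t : ℝ ↦ t ^ (b - 1) * (1 - t) ^ (c - b - 1) * (1 - z * t) ^ (-a)) (Ioo 0 1) := by
    refine Integrable.mono' hi (by fun_prop) ?_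
    filter_upwards [ae_restrict_mem measurableSet_Ioo] with t ht
    rw [Real.norm_of_nonneg (mul_nonneg (hw0 t ht)
      (Real.rpow_nonneg (by linarith [hzt t ht, ht.2]) _))]
    exact hle t ht
  refine ⟨by positivity, ?_, ?_⟩
  · refine le_of_mul_le_mul_left ?_ hB
    rw [hratio, beta_mul_hypF_eq_integral ha hb hcb hz, ← hIa]
    exact setIntegral_mono_on hia him measurableSet_Ioo hge
  · refine le_of_mul_le_mul_left ?_ hB
    rw [mul_one, beta_mul_hypF_eq_integral ha hb hcb hz, ← hI]
    exact setIntegral_mono_on him hi measurableSet_Ioo hle
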